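/- arXiv:2504.03525 — 3 statements merged into one kernel-verified Lean document; each statement's English description precedes it below -/
import Mathlib

section
/- Let E be a real normed vector space, S ⊆ E a nonempty set, x ∈ E, and p ∈ S a closest point to x, i.e. dist(x, p) = infDist(x, S). Then for every point y on the segment from p to x, infDist(y, S) = dist(y, p); that is, p is also a closest point of S to every point of the segment. -/
open Metric

/-- If `p` is a closest point of `S` to `x`, then `p` is a closest point of `S`
to every point `y` on the segment from `p` to `x`, with `infDist y S = dist y p`. -/
theorem infDist_eq_dist_on_segment {E : Type*} [NormedAddCommGroup E] [NormedSpace ℝ E]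
    (S : Set E) (hS : S.Nonempty) (x : E) (p : E) (hp : p ∈ S)
    (hclosest : dist x p = infDist x S) :
    ∀ y ∈ segment ℝ p x, infDist y S = dist y p := by
  intro y hy
  refine le_antisymm (infDist_le_dist_of_mem hp) ?_
  have hsplit := dist_add_dist_of_mem_segment hy
  have hlip : infDist x S ≤ infDist y S + dist x y := infDist_le_infDist_add_dist
  rw [dist_comm p y, dist_comm y x, dist_comm p x] at hsplit
  linarith
end

section
/- Let S be a nonempty subset of a real inner product space E, x ∈ E, and p ∈ S a closest point to x, i.e. dist(x, p) = infDist(x, S). Let y = p + t·(x − p) with 0 < t < 1. Then p is the unique closest point of S to y: for every q ∈ S with dist(y, q) = infDist(y, S), one has q = p. -/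
open Metric

/-- Strict interior points of the segment to the closest point have a unique
closest point in `S`, namely `p` itself. -/
theorem closest_point_unique_on_open_segment {E : Type*} [NormedAddCommGroup E]
    [InnerProductSpace ℝ E] (S : Set E) (hS : S.Nonempty) (x p : E) (hp : p ∈ S)
    (hclosest : dist x p = infDist x S) (t : ℝ) (ht0 : 0 < t) (ht1 : t < 1) :
    ∀ q ∈ S, dist (p + t • (x - p)) q = infDist (p + t • (x - p)) S → q = p := by
  intro q hq hyq
  have hx : ‖x - p‖ ≤ ‖(x - p) - (q - p)‖ := by
    rw [sub_sub_sub_cancel_right, ← dist_eq_norm, ← dist_eq_norm, hclosest]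
    exact infDist_le_dist_of_mem hq
  have hy : ‖t • (x - p) - (q - p)‖ ≤ ‖t • (x - p)‖ := by
    have h : dist (p + t • (x - p)) q ≤ dist (p + t • (x - p)) p :=
      hyq.trans_le (infDist_le_dist_of_mem hp)
    rw [dist_eq_norm, dist_eq_norm, add_sub_cancel_left] at h
    rwa [show t • (x - p) - (q - p) = p + t • (x - p) - q by abel]
  have hx2 := pow_le_pow_left₀ (norm_nonneg _) hx 2
  have hy2 := pow_le_pow_left₀ (norm_nonneg _) hy 2
  rw [norm_sub_sq_real (x - p)] at hx2
  rw [norm_sub_sq_real] at hy2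
  rw [real_inner_smul_left] at hy2
  have hw : ‖q - p‖ ^ 2 = 0 := by
    have ht := mul_le_mul_of_nonneg_left hx2 ht0.le
    nlinarith [sq_nonneg ‖q - p‖]
  exact sub_eq_zero.mp (norm_eq_zero.mp (pow_eq_zero_iff two_ne_zero |>.mp hw))
end

section
/- Let S be a nonempty subset of a real inner product space E (e.g. EuclideanSpace ℝ (Fin d)), x ∈ E, and p ∈ S with dist(x, p) = infDist(x, S) > 0. If the distance function h(y) := infDist(y, S) is differentiable at x, then its gradient at x equals the unit vector (x − p)/‖x − p‖; equivalently, the Fréchet derivative of h at x is the linear map v ↦ ⟪(x − p)/‖x − p‖, v⟫. -/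
open Metric

/-- If the distance function to `S` is differentiable at `x` and `p` is a
closest point of `S` to `x` at positive distance, then the Fréchet derivative
of the distance function at `x` is the inner product with the unit vector
`(x - p) / ‖x - p‖`. -/
theorem fderiv_infDist_eq_inner_unit {E : Type*} [NormedAddCommGroup E]
    [InnerProductSpace ℝ E] (S : Set E) (hS : S.Nonempty) (x p : E) (hp : p ∈ S)
    (hclosest : dist x p = infDist x S) (hpos : 0 < infDist x S)
    (hdiff : DifferentiableAt ℝ (fun y => infDist y S) x) :
    fderiv ℝ (fun y => infDist y S) x = innerSL ℝ ((‖x - p‖)⁻¹ • (x - p)) := by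
  have hnorm : ‖x - p‖ = infDist x S := by rw [← dist_eq_norm, hclosest]
  -- The nonnegative function `‖y - p‖ ^ 2 - infDist y S ^ 2` vanishes, hence is minimal, at `x`.
  have hmin : IsLocalMin (fun y => ‖y - p‖ ^ 2 - infDist y S ^ 2) x := by
    refine Filter.Eventually.of_forall fun y => ?_
    have hle : infDist y S ≤ ‖y - p‖ := dist_eq_norm y p ▸ infDist_le_dist_of_mem hp
    have hsq := pow_le_pow_left₀ infDist_nonneg hle 2
    simpa [hnorm] using hsq
  have hderiv := ((hasFDerivAt_id x).sub_const p).norm_sq.sub (hdiff.hasFDerivAt.pow 2)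
  have hzero := hmin.hasFDerivAt_eq_zero hderiv
  ext v
  have hv := DFunLike.congr_fun hzero v
  simp at hv
  simp only [innerSL_apply_apply, real_inner_smul_left, hnorm]
  field_simp
  rw [inner_sub_left]
  linarith
end
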